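/- arXiv:2107.01649 — 5 statements merged into one kernel-verified Lean document; each statement's English description precedes it below -/
import Mathlib

section
/- Fix a coefficient α ≥ 1 and a number of agents n. Let f be any mechanism mapping profiles (x,σ) to facility locations y ∈ [0,1]². If, for every instance, the total utility of f's output computed with coefficient 1 is at least 1/β times the optimal total utility with coefficient 1, then for every instance the total utility of f's output computed with coefficient α is at least 1/(βα) times the optimal total utility with coefficient α. The same implication holds with the minimum utility objective in place of the total utility objective. -/
open scoped BigOperators

noncomputable section

/-- A location profile of `n` agents on the line. -/
abbrev Loc (n : ℕ) := Fin n → ℝ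

/-- A preference profile: `true` means the agent prefers facility `F₁`,
`false` means the agent prefers facility `F₂`. -/
abbrev Pref (n : ℕ) := Fin n → Bool

/-- All agent locations lie in the unit interval `[0,1]`. -/
def validLoc {n : ℕ} (x : Loc n) : Prop := ∀ i, x i ∈ Set.Icc (0:ℝ) 1

/-- The pair of facility locations lies in `[0,1]²`. -/
def inBox (y : ℝ × ℝ) : Prop := y.1 ∈ Set.Icc (0:ℝ) 1 ∧ y.2 ∈ Set.Icc (0:ℝ) 1

/-- The location of the facility indexed by `b` (`true` = `F₁`, `false` = `F₂`). -/
def facLoc (y : ℝ × ℝ) (b : Bool) : ℝ := if b then y.1 else y.2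

/-- Cost of an agent located at `xi` whose preferred facility is `σi`:
`min(|xi − y_{σi}|, α·|xi − y_{3−σi}|)`. -/
def cost (α xi : ℝ) (σi : Bool) (y : ℝ × ℝ) : ℝ :=
  min |xi - facLoc y σi| (α * |xi - facLoc y (!σi)|)

/-- Utility of an agent located at `xi` whose preferred facility is `σi`:
`max(1 − |xi − y_{σi}|, (1 − |xi − y_{3−σi}|)/α)`. -/
def util (α xi : ℝ) (σi : Bool) (y : ℝ × ℝ) : ℝ :=
  max (1 - |xi - facLoc y σi|) ((1 - |xi - facLoc y (!σi)|) / α)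

/-- Total cost. -/
def SC {n : ℕ} (α : ℝ) (x : Loc n) (σ : Pref n) (y : ℝ × ℝ) : ℝ :=
  ∑ i, cost α (x i) (σ i) y

/-- Maximum cost. -/
def BC {n : ℕ} (α : ℝ) (x : Loc n) (σ : Pref n) (y : ℝ × ℝ) : ℝ :=
  ⨆ i, cost α (x i) (σ i) y

/-- Total utility. -/
def SU {n : ℕ} (α : ℝ) (x : Loc n) (σ : Pref n) (y : ℝ × ℝ) : ℝ :=
  ∑ i, util α (x i) (σ i) y

/-- Minimum utility. -/
def BU {n : ℕ} (α : ℝ) (x : Loc n) (σ : Pref n) (y : ℝ × ℝ) : ℝ :=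
  ⨅ i, util α (x i) (σ i) y

/-- Optimal (minimal) total cost over `y ∈ [0,1]²`. -/
def optSC {n : ℕ} (α : ℝ) (x : Loc n) (σ : Pref n) : ℝ :=
  sInf {c | ∃ y, inBox y ∧ c = SC α x σ y}

/-- Optimal (minimal) maximum cost over `y ∈ [0,1]²`. -/
def optBC {n : ℕ} (α : ℝ) (x : Loc n) (σ : Pref n) : ℝ :=
  sInf {c | ∃ y, inBox y ∧ c = BC α x σ y}

/-- Optimal (maximal) total utility over `y ∈ [0,1]²`. -/
def optSU {n : ℕ} (α : ℝ) (x : Loc n) (σ : Pref n) : ℝ :=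
  sSup {c | ∃ y, inBox y ∧ c = SU α x σ y}

/-- Optimal (maximal) minimum utility over `y ∈ [0,1]²`. -/
def optBU {n : ℕ} (α : ℝ) (x : Loc n) (σ : Pref n) : ℝ :=
  sSup {c | ∃ y, inBox y ∧ c = BU α x σ y}

/-- Strategyproofness in the private-preferences setting (cost version):
no agent can strictly decrease his cost by misreporting his preference. -/
def SPprefCost {n : ℕ} (α : ℝ) (f : Loc n → Pref n → ℝ × ℝ) : Prop :=
  ∀ x : Loc n, validLoc x → ∀ σ : Pref n, ∀ i : Fin n, ∀ b : Bool,
    cost α (x i) (σ i) (f x σ) ≤ cost α (x i) (σ i) (f x (Function.update σ i b))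

/-- Strategyproofness in the private-preferences setting (utility version):
no agent can strictly increase his utility by misreporting his preference. -/
def SPprefUtil {n : ℕ} (α : ℝ) (f : Loc n → Pref n → ℝ × ℝ) : Prop :=
  ∀ x : Loc n, validLoc x → ∀ σ : Pref n, ∀ i : Fin n, ∀ b : Bool,
    util α (x i) (σ i) (f x (Function.update σ i b)) ≤ util α (x i) (σ i) (f x σ)

/-- Group strategyproofness in the private-preferences setting (cost version):
for every joint misreport of preferences, some deviating agent does not
strictly decrease his cost. -/
def GSPprefCost {n : ℕ} (α : ℝ) (f : Loc n → Pref n → ℝ × ℝ) : Prop :=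
  ∀ x : Loc n, validLoc x → ∀ σ σ' : Pref n, σ' ≠ σ →
    ∃ i : Fin n, σ' i ≠ σ i ∧
      cost α (x i) (σ i) (f x σ) ≤ cost α (x i) (σ i) (f x σ')

/-- Group strategyproofness in the private-preferences setting (utility version). -/
def GSPprefUtil {n : ℕ} (α : ℝ) (f : Loc n → Pref n → ℝ × ℝ) : Prop :=
  ∀ x : Loc n, validLoc x → ∀ σ σ' : Pref n, σ' ≠ σ →
    ∃ i : Fin n, σ' i ≠ σ i ∧
      util α (x i) (σ i) (f x σ') ≤ util α (x i) (σ i) (f x σ)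

/-- Strategyproofness in the private-locations setting (cost version). -/
def SPlocCost {n : ℕ} (α : ℝ) (f : Loc n → Pref n → ℝ × ℝ) : Prop :=
  ∀ x : Loc n, validLoc x → ∀ σ : Pref n, ∀ i : Fin n, ∀ z ∈ Set.Icc (0:ℝ) 1,
    cost α (x i) (σ i) (f x σ) ≤ cost α (x i) (σ i) (f (Function.update x i z) σ)

/-- Strategyproofness in the private-locations setting (utility version). -/
def SPlocUtil {n : ℕ} (α : ℝ) (f : Loc n → Pref n → ℝ × ℝ) : Prop :=
  ∀ x : Loc n, validLoc x → ∀ σ : Pref n, ∀ i : Fin n, ∀ z ∈ Set.Icc (0:ℝ) 1,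
    util α (x i) (σ i) (f (Function.update x i z) σ) ≤ util α (x i) (σ i) (f x σ)

/-- Group strategyproofness in the private-locations setting (cost version). -/
def GSPlocCost {n : ℕ} (α : ℝ) (f : Loc n → Pref n → ℝ × ℝ) : Prop :=
  ∀ x : Loc n, validLoc x → ∀ σ : Pref n, ∀ x' : Loc n, validLoc x' → x' ≠ x →
    ∃ i : Fin n, x' i ≠ x i ∧
      cost α (x i) (σ i) (f x σ) ≤ cost α (x i) (σ i) (f x' σ)

/-- Anonymity: the output is invariant under simultaneous permutations of the agents. -/
def Anonymous {n : ℕ} (f : Loc n → Pref n → ℝ × ℝ) : Prop :=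
  ∀ (x : Loc n) (σ : Pref n) (π : Equiv.Perm (Fin n)), f (x ∘ π) (σ ∘ π) = f x σ

/-- Mechanism 1: `F₁` at `(lt+lb)/2` and `F₂` at `(rt+rb)/2`, where `lt`,`rt` are the
extreme agent locations, `cen` their midpoint, `lb` (`rb`) the agent location closest
to `cen` from the left (right). -/
def mech1 {n : ℕ} (x : Loc n) : ℝ × ℝ :=
  ((⨅ i, x i) / 2 + sSup {z | (∃ i, x i = z) ∧ z ≤ ((⨅ i, x i) + (⨆ i, x i)) / 2} / 2,
   (⨆ i, x i) / 2 + sInf {z | (∃ i, x i = z) ∧ ((⨅ i, x i) + (⨆ i, x i)) / 2 ≤ z} / 2)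

/-- Mechanism 2: `F₁` at the midpoint of the extreme locations of agents reporting
preference `F₁`, and likewise for `F₂`. -/
def mech2 {n : ℕ} (x : Loc n) (σ : Pref n) : ℝ × ℝ :=
  ((sInf {z | ∃ i, σ i = true ∧ x i = z} + sSup {z | ∃ i, σ i = true ∧ x i = z}) / 2,
   (sInf {z | ∃ i, σ i = false ∧ x i = z} + sSup {z | ∃ i, σ i = false ∧ x i = z}) / 2)

/-- Mechanism 3: both facilities at `1/2`. -/
def mech3 : ℝ × ℝ := (1/2, 1/2)

/-- Mechanism 4: facilities at the two extreme reported locations. -/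
def mech4 {n : ℕ} (x : Loc n) : ℝ × ℝ := (⨅ i, x i, ⨆ i, x i)

end

lemma abs_sub_facLoc_le_one {xi : ℝ} (hx : xi ∈ Set.Icc (0:ℝ) 1) {y : ℝ × ℝ} (hy : inBox y)
    (b : Bool) : |xi - facLoc y b| ≤ 1 := by
  obtain ⟨⟨h1, h2⟩, h3, h4⟩ := hy
  obtain ⟨h5, h6⟩ := hx
  rw [abs_le]
  cases b <;> simp only [facLoc, Bool.false_eq_true, if_true, if_false] <;>
    constructor <;> linarith

lemma util_le_util_one {α : ℝ} (hα : 1 ≤ α) {xi : ℝ} (hx : xi ∈ Set.Icc (0:ℝ) 1) (s : Bool)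
    {y : ℝ × ℝ} (hy : inBox y) : util α xi s y ≤ util 1 xi s y := by
  have h := abs_sub_facLoc_le_one hx hy (!s)
  unfold util
  gcongr

lemma util_one_div_le_util {α : ℝ} (hα : 1 ≤ α) {xi : ℝ} (hx : xi ∈ Set.Icc (0:ℝ) 1) (s : Bool)
    {y : ℝ × ℝ} (hy : inBox y) : util 1 xi s y / α ≤ util α xi s y := by
  have h := abs_sub_facLoc_le_one hx hy s
  unfold util
  rw [← max_div_div_right (by linarith), div_one]
  gcongr
  exact div_le_self (by linarith) hα

lemma util_one_le_one (xi : ℝ) (s : Bool) (y : ℝ × ℝ) : util 1 xi s y ≤ 1 := by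
  unfold util
  rw [div_one]
  exact max_le (sub_le_self _ (abs_nonneg _)) (sub_le_self _ (abs_nonneg _))

lemma SU_le_SU_one {n : ℕ} {α : ℝ} (hα : 1 ≤ α) {x : Loc n} (hx : validLoc x) (σ : Pref n)
    {y : ℝ × ℝ} (hy : inBox y) : SU α x σ y ≤ SU 1 x σ y :=
  Finset.sum_le_sum fun i _ => util_le_util_one hα (hx i) (σ i) hy

lemma SU_one_div_le_SU {n : ℕ} {α : ℝ} (hα : 1 ≤ α) {x : Loc n} (hx : validLoc x) (σ : Pref n)
    {y : ℝ × ℝ} (hy : inBox y) : SU 1 x σ y / α ≤ SU α x σ y := by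
  unfold SU
  rw [Finset.sum_div]
  exact Finset.sum_le_sum fun i _ => util_one_div_le_util hα (hx i) (σ i) hy

lemma SU_one_le {n : ℕ} (x : Loc n) (σ : Pref n) (y : ℝ × ℝ) : SU 1 x σ y ≤ n := by
  simpa [SU] using
    Finset.sum_le_sum fun (i : Fin n) (_ : i ∈ Finset.univ) => util_one_le_one (x i) (σ i) y

lemma BU_le_BU_one {n : ℕ} {α : ℝ} (hα : 1 ≤ α) {x : Loc n} (hx : validLoc x) (σ : Pref n)
    {y : ℝ × ℝ} (hy : inBox y) : BU α x σ y ≤ BU 1 x σ y :=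
  ciInf_mono (Set.finite_range _).bddBelow fun i => util_le_util_one hα (hx i) (σ i) hy

lemma BU_one_div_le_BU {n : ℕ} {α : ℝ} (hα : 1 ≤ α) {x : Loc n} (hx : validLoc x) (σ : Pref n)
    {y : ℝ × ℝ} (hy : inBox y) : BU 1 x σ y / α ≤ BU α x σ y := by
  unfold BU
  rcases isEmpty_or_nonempty (Fin n) with _ | _
  · simp [Real.iInf_of_isEmpty]
  · refine le_ciInf fun i => le_trans ?_ (util_one_div_le_util hα (hx i) (σ i) hy)
    gcongr
    exact ciInf_le (Set.finite_range _).bddBelow i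

lemma BU_one_le_one {n : ℕ} (x : Loc n) (σ : Pref n) (y : ℝ × ℝ) : BU 1 x σ y ≤ 1 := by
  unfold BU
  rcases isEmpty_or_nonempty (Fin n) with _ | ⟨⟨i⟩⟩
  · simp [Real.iInf_of_isEmpty]
  · exact (ciInf_le (Set.finite_range _).bddBelow i).trans (util_one_le_one _ _ _)

/-- If `H / α ≤ G` at `z` and `G ≤ H` on the box, a `β`-approximation of the optimum of `H`
at `z` is a `βα`-approximation of the optimum of `G`. -/
lemma sSup_div_mul_le_of_sandwich {G H : ℝ × ℝ → ℝ} {α β C : ℝ} {z : ℝ × ℝ} (hα : 0 < α)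
    (hβ : 0 < β) (hz : inBox z) (hGH : ∀ y, inBox y → G y ≤ H y) (hC : ∀ y, H y ≤ C)
    (hHG : H z / α ≤ G z) (h : sSup {c | ∃ y, inBox y ∧ c = H y} / β ≤ H z) :
    sSup {c | ∃ y, inBox y ∧ c = G y} / (β * α) ≤ G z := by
  have hbdd : BddAbove {c | ∃ y, inBox y ∧ c = H y} := by
    refine ⟨C, ?_⟩
    rintro _ ⟨y, -, rfl⟩
    exact hC y
  have hle : sSup {c | ∃ y, inBox y ∧ c = G y} ≤ sSup {c | ∃ y, inBox y ∧ c = H y} := by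
    refine csSup_le ⟨_, z, hz, rfl⟩ ?_
    rintro _ ⟨y, hy, rfl⟩
    exact (hGH y hy).trans (le_csSup hbdd ⟨y, hy, rfl⟩)
  rw [← div_div]
  refine le_trans ?_ hHG
  gcongr
  refine le_trans ?_ h
  gcongr

/-- Proposition 1 (utility objectives): if a mechanism is `β`-approximate for coefficient 1
under the total (resp. minimum) utility objective, then it is `βα`-approximate for
coefficient `α` under the same objective. -/
theorem stmt_1 (α : ℝ) (hα : 1 ≤ α) (n : ℕ) (β : ℝ) (hβ : 1 ≤ β)
    (f : Loc n → Pref n → ℝ × ℝ) (hbox : ∀ x σ, inBox (f x σ)) :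
    ((∀ x : Loc n, validLoc x → ∀ σ : Pref n, optSU 1 x σ / β ≤ SU 1 x σ (f x σ)) →
      ∀ x : Loc n, validLoc x → ∀ σ : Pref n,
        optSU α x σ / (β * α) ≤ SU α x σ (f x σ)) ∧
    ((∀ x : Loc n, validLoc x → ∀ σ : Pref n, optBU 1 x σ / β ≤ BU 1 x σ (f x σ)) →
      ∀ x : Loc n, validLoc x → ∀ σ : Pref n,
        optBU α x σ / (β * α) ≤ BU α x σ (f x σ)) := by
  have hα' : 0 < α := by linarith
  have hβ' : 0 < β := by linarith
  exact ⟨fun h x hx σ => sSup_div_mul_le_of_sandwich hα' hβ' (hbox x σ)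
      (fun _ => SU_le_SU_one hα hx σ) (SU_one_le x σ) (SU_one_div_le_SU hα hx σ (hbox x σ))
      (h x hx σ),
    fun h x hx σ => sSup_div_mul_le_of_sandwich hα' hβ' (hbox x σ)
      (fun _ => BU_le_BU_one hα hx σ) (BU_one_le_one x σ) (BU_one_div_le_BU hα hx σ (hbox x σ))
      (h x hx σ)⟩
end

section
/- For every coefficient α ≥ 1 and every number of agents n, Mechanism 1 is group strategyproof in the private-preferences setting and α-approximate under the maximum cost objective. -/
open scoped BigOperators

/-- An agent's cost is at least the distance to the nearest facility. -/
lemma min_dist_le_cost {α : ℝ} (hα : 1 ≤ α) (z : ℝ) (b : Bool) (y : ℝ × ℝ) :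
    min |z - y.1| |z - y.2| ≤ cost α z b y := by
  have h1 := le_mul_of_one_le_left (abs_nonneg (z - y.1)) hα
  have h2 := le_mul_of_one_le_left (abs_nonneg (z - y.2)) hα
  cases b <;> simp only [cost, facLoc, Bool.not_true, Bool.not_false, if_true,
    Bool.false_eq_true, if_false] <;> grind

/-- An agent's cost is at most `α` times the distance to the first facility. -/
lemma cost_le_mul_dist_fst {α : ℝ} (hα : 1 ≤ α) (z : ℝ) (b : Bool) (y : ℝ × ℝ) :
    cost α z b y ≤ α * |z - y.1| := by
  have h1 := le_mul_of_one_le_left (abs_nonneg (z - y.1)) hα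
  cases b
  · exact min_le_right _ _
  · exact (min_le_left _ _).trans h1

/-- An agent's cost is at most `α` times the distance to the second facility. -/
lemma cost_le_mul_dist_snd {α : ℝ} (hα : 1 ≤ α) (z : ℝ) (b : Bool) (y : ℝ × ℝ) :
    cost α z b y ≤ α * |z - y.2| := by
  have h1 := le_mul_of_one_le_left (abs_nonneg (z - y.2)) hα
  cases b
  · exact (min_le_left _ _).trans h1
  · exact min_le_right _ _

lemma cost_le_BC {n : ℕ} (α : ℝ) (x : Loc n) (σ : Pref n) (y : ℝ × ℝ) (i : Fin n) :
    cost α (x i) (σ i) y ≤ BC α x σ y :=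
  le_ciSup (f := fun i => cost α (x i) (σ i) y) (Set.finite_range _).bddAbove i

/-- If three points are each within distance `D` of one of two facilities, then some two of them
are within distance `2 * D` of each other. -/
lemma exists_dist_le_two_mul_of_three_points {a b c u v D : ℝ}
    (ha : min |a - u| |a - v| ≤ D) (hb : min |b - u| |b - v| ≤ D)
    (hc : min |c - u| |c - v| ≤ D) :
    |a - b| ≤ 2 * D ∨ |b - c| ≤ 2 * D ∨ |a - c| ≤ 2 * D := by
  have key : ∀ p q w : ℝ, |p - w| ≤ D → |q - w| ≤ D → |p - q| ≤ 2 * D := fun p q w hp hq => by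
    have := abs_sub_le p w q
    rw [abs_sub_comm w q] at this
    linarith
  rw [min_le_iff] at ha hb hc
  rcases ha with ha | ha <;> rcases hb with hb | hb <;> rcases hc with hc | hc <;>
  first
    | exact Or.inl (key _ _ _ ha hb)
    | exact Or.inr (Or.inl (key _ _ _ hb hc))
    | exact Or.inr (Or.inr (key _ _ _ ha hc))

/-- The maximum cost of any facility pair is at least half the distance of some two of any three
agents. -/
lemma exists_dist_le_two_mul_BC {n : ℕ} {α : ℝ} (hα : 1 ≤ α) (x : Loc n) (σ : Pref n) (y : ℝ × ℝ)
    (i j k : Fin n) :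
    |x i - x j| ≤ 2 * BC α x σ y ∨ |x j - x k| ≤ 2 * BC α x σ y ∨
      |x i - x k| ≤ 2 * BC α x σ y := by
  have h : ∀ l, min |x l - y.1| |x l - y.2| ≤ BC α x σ y := fun l =>
    (min_dist_le_cost hα _ _ _).trans (cost_le_BC α x σ y l)
  exact exists_dist_le_two_mul_of_three_points (h i) (h j) (h k)

/-- The maximum cost of Mechanism 1 is at most `α` times that of any facility pair. -/
lemma BC_mech1_le {n : ℕ} {α : ℝ} (hα : 1 ≤ α) (x : Loc n) (σ : Pref n) (y : ℝ × ℝ) :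
    BC α x σ (mech1 x) ≤ α * BC α x σ y := by
  rcases isEmpty_or_nonempty (Fin n) with hn | hn
  · simp [BC, Real.iSup_of_isEmpty]
  obtain ⟨iL, hL⟩ := exists_eq_ciInf_of_finite (f := x)
  obtain ⟨iR, hR⟩ := exists_eq_ciSup_of_finite (f := x)
  have hmin : ∀ i, x iL ≤ x i := fun i => hL ▸ ciInf_le (Set.finite_range x).bddBelow i
  have hmax : ∀ i, x i ≤ x iR := fun i => hR ▸ le_ciSup (Set.finite_range x).bddAbove i
  have hLR := hmin iR
  set A : Set ℝ := {z | (∃ i, x i = z) ∧ z ≤ ((⨅ i, x i) + (⨆ i, x i)) / 2} with hA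
  set B : Set ℝ := {z | (∃ i, x i = z) ∧ ((⨅ i, x i) + (⨆ i, x i)) / 2 ≤ z} with hB
  have hAfin : A.Finite := (Set.finite_range x).subset fun z hz => hz.1
  have hBfin : B.Finite := (Set.finite_range x).subset fun z hz => hz.1
  have hAne : A.Nonempty := ⟨x iL, ⟨iL, rfl⟩, by linarith⟩
  have hBne : B.Nonempty := ⟨x iR, ⟨iR, rfl⟩, by linarith⟩
  obtain ⟨⟨iA, hiA⟩, hAcen⟩ := hAne.csSup_mem hAfin
  obtain ⟨⟨iB, hiB⟩, hBcen⟩ := hBne.csInf_mem hBfin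
  have hy1 : (mech1 x).1 = x iL / 2 + x iA / 2 := by rw [hL, hiA]; rfl
  have hy2 : (mech1 x).2 = x iR / 2 + x iB / 2 := by rw [hR, hiB]; rfl
  have hAmax : ∀ i, x i ≤ (x iL + x iR) / 2 → x i ≤ x iA := fun i hi => by
    rw [hL, hR] at hi
    exact hiA ▸ le_csSup hAfin.bddAbove ⟨⟨i, rfl⟩, hi⟩
  have hBmin : ∀ i, (x iL + x iR) / 2 ≤ x i → x iB ≤ x i := fun i hi => by
    rw [hL, hR] at hi
    exact hiB ▸ csInf_le hBfin.bddBelow ⟨⟨i, rfl⟩, hi⟩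
  rw [← hiA, ← hL, ← hR] at hAcen
  rw [← hiB, ← hL, ← hR] at hBcen
  have hleft : x iA - x iL ≤ 2 * BC α x σ y := by
    rcases exists_dist_le_two_mul_BC hα x σ y iL iA iR with h | h | h <;>
      linarith [hmin iA, (abs_le.1 h).1]
  have hright : x iR - x iB ≤ 2 * BC α x σ y := by
    rcases exists_dist_le_two_mul_BC hα x σ y iL iB iR with h | h | h <;>
      linarith [hmax iB, (abs_le.1 h).1]
  refine ciSup_le fun i => ?_
  rcases le_total (x i) ((x iL + x iR) / 2) with hi | hi
  · refine (cost_le_mul_dist_fst hα _ _ _).trans (mul_le_mul_of_nonneg_left ?_ (by linarith))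
    rw [hy1, abs_le]
    constructor <;> linarith [hmin i, hAmax i hi]
  · refine (cost_le_mul_dist_snd hα _ _ _).trans (mul_le_mul_of_nonneg_left ?_ (by linarith))
    rw [hy2, abs_le]
    constructor <;> linarith [hmax i, hBmin i hi]

/-- Mechanism 1 is group strategyproof with private preferences and `α`-approximate
under the maximum cost objective. -/
theorem stmt_2 (α : ℝ) (hα : 1 ≤ α) (n : ℕ) :
    GSPprefCost α (fun (x : Loc n) (_ : Pref n) => mech1 x) ∧
    ∀ x : Loc n, validLoc x → ∀ σ : Pref n,
      BC α x σ (mech1 x) ≤ α * optBC α x σ := by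
  refine ⟨fun x _ σ σ' hne => ?_, fun x _ σ => ?_⟩
  · obtain ⟨i, hi⟩ := Function.ne_iff.1 hne
    exact ⟨i, hi, le_rfl⟩
  · have hpos : 0 < α := by linarith
    rw [← div_le_iff₀' hpos]
    refine le_csInf ⟨_, (0, 0), by simp [inBox], rfl⟩ ?_
    rintro _ ⟨y, _, rfl⟩
    rw [div_le_iff₀' hpos]
    exact BC_mech1_le hα x σ y
end

section
/- Fix a coefficient α ≥ 1. In the private-preferences setting with n = 4 agents, no strategyproof mechanism is r-approximate under the total cost objective for any r < max{1, α/4}. -/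
open scoped BigOperators

lemma cost_nonneg {α : ℝ} (hα : 0 ≤ α) (z : ℝ) (b : Bool) (y : ℝ × ℝ) : 0 ≤ cost α z b y :=
  le_min (abs_nonneg _) (mul_nonneg hα (abs_nonneg _))

lemma cost_self_nonpos (α z w : ℝ) (b : Bool) : cost α z b (w, z) ≤ 0 := by
  cases b <;> simp [cost, facLoc]

lemma cost_true_le (α z : ℝ) (y : ℝ × ℝ) : cost α z true y ≤ |z - y.1| := by
  simp [cost, facLoc]

lemma cost_false_le (α z : ℝ) (y : ℝ × ℝ) : cost α z false y ≤ |z - y.2| := by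
  simp [cost, facLoc]

lemma SC_nonneg {n : ℕ} {α : ℝ} (hα : 0 ≤ α) (x : Loc n) (σ : Pref n) (y : ℝ × ℝ) :
    0 ≤ SC α x σ y :=
  Finset.sum_nonneg fun _ _ => cost_nonneg hα _ _ _

lemma cost_le_SC {n : ℕ} {α : ℝ} (hα : 0 ≤ α) (x : Loc n) (σ : Pref n) (y : ℝ × ℝ) (i : Fin n) :
    cost α (x i) (σ i) y ≤ SC α x σ y :=
  Finset.single_le_sum (f := fun i => cost α (x i) (σ i) y)
    (fun _ _ => cost_nonneg hα _ _ _) (Finset.mem_univ i)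

lemma optSC_nonneg {n : ℕ} {α : ℝ} (hα : 0 ≤ α) (x : Loc n) (σ : Pref n) : 0 ≤ optSC α x σ := by
  apply Real.sInf_nonneg
  rintro _ ⟨y, -, rfl⟩
  exact SC_nonneg hα x σ y

lemma optSC_le {n : ℕ} {α : ℝ} (hα : 0 ≤ α) (x : Loc n) (σ : Pref n) {y : ℝ × ℝ}
    (hy : inBox y) : optSC α x σ ≤ SC α x σ y := by
  refine csInf_le ⟨0, ?_⟩ ⟨y, hy, rfl⟩
  rintro _ ⟨z, -, rfl⟩
  exact SC_nonneg hα x σ z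

/-- An agent of zero cost is located at one of the two facilities. -/
lemma eq_facility_of_cost_nonpos {α : ℝ} (hα : 0 < α) {z : ℝ} {y : ℝ × ℝ}
    (h : cost α z true y ≤ 0) : z = y.1 ∨ z = y.2 := by
  rcases min_le_iff.1 h with h | h
  · left
    simpa [facLoc, sub_eq_zero] using h
  · right
    have h' := nonpos_of_mul_nonpos_right h hα
    simpa [facLoc, sub_eq_zero] using h'

/-- A mechanism with outputs in the box cannot be better than optimal. -/
lemma one_le_ratio {α : ℝ} (hα : 1 ≤ α) (f : Loc 4 → Pref 4 → ℝ × ℝ)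
    (hbox : ∀ x σ, inBox (f x σ)) (r : ℝ)
    (happrox : ∀ x : Loc 4, validLoc x → ∀ σ : Pref 4,
      SC α x σ (f x σ) ≤ r * optSC α x σ) : 1 ≤ r := by
  have hα0 : 0 < α := by linarith
  let x : Loc 4 := ![0, 1 / 2, 1, 1]
  let σ : Pref 4 := fun _ => true
  have hx : validLoc x := by
    intro i
    fin_cases i <;> simp [x] <;> norm_num
  have hpos : 0 < SC α x σ (f x σ) := by
    by_contra! h
    have key : ∀ i, x i = (f x σ).1 ∨ x i = (f x σ).2 := fun i =>
      eq_facility_of_cost_nonpos hα0 ((cost_le_SC hα0.le x σ _ i).trans h)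
    have h0 : 0 = (f x σ).1 ∨ 0 = (f x σ).2 := key 0
    have h1 : 1 / 2 = (f x σ).1 ∨ 1 / 2 = (f x σ).2 := key 1
    have h2 : 1 = (f x σ).1 ∨ 1 = (f x σ).2 := key 2
    rcases h0 with h0 | h0 <;> rcases h1 with h1 | h1 <;> rcases h2 with h2 | h2 <;> linarith
  have h1 := happrox x hx σ
  have h2 := optSC_le hα0.le x σ (hbox x σ)
  have h3 := optSC_nonneg hα0.le x σ
  by_contra! hr
  rcases h3.eq_or_lt with h3 | h3
  · rw [← h3, mul_zero] at h1
    linarith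
  · linarith [mul_lt_of_lt_one_left h3 hr]

/-- If two agents at `0` and `ε` who prefer `F₁` both have small cost, then `F₁` is on the left. -/
lemma fst_lt_of_cost_lt {α ε : ℝ} (hα : 4 < α) (hε : α * ε = 1 / 4) {y : ℝ × ℝ}
    (hA : cost α 0 true y < 1 / 8) (hB : cost α ε true y < 1 / 8) : y.1 < 1 / 2 := by
  have hε' : ε < 1 / 16 := by nlinarith
  simp only [cost, facLoc, min_lt_iff, if_true, Bool.not_true, Bool.false_eq_true, if_false,
    zero_sub, abs_neg] at hA hB
  rcases hA with hA | hA
  · linarith [le_abs_self y.1]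
  · rcases hB with hB | hB
    · linarith [neg_abs_le (ε - y.1)]
    · nlinarith [le_abs_self y.2, le_abs_self (ε - y.2)]

/-- If `F₁` is on the left and an agent on the right who prefers `F₁` has small cost, then
`F₂` is close to that agent. -/
lemma dist_snd_lt_of_cost_lt {α ε z : ℝ} (hα : 4 < α) (hε : α * ε = 1 / 4) {y : ℝ × ℝ}
    (hz : 3 / 4 ≤ z) (hy : y.1 < 1 / 2) (hC : cost α z true y < 1 / 8) :
    |z - y.2| < ε / 2 := by
  simp only [cost, facLoc, min_lt_iff, if_true, Bool.not_true, Bool.false_eq_true, if_false] at hC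
  rcases hC with hC | hC
  · linarith [le_abs_self (z - y.1)]
  · nlinarith

/-- If `F₁` is on the left and an agent on the right who prefers `F₂` has cost less than `ε / 2`,
then `F₂` is close to that agent. -/
lemma dist_snd_lt_of_cost_false_lt {α ε z : ℝ} (hα : 4 < α) (hε : α * ε = 1 / 4) {y : ℝ × ℝ}
    (hz : 3 / 4 ≤ z) (hy : y.1 < 1 / 2) (hC : cost α z false y < ε / 2) :
    |z - y.2| < ε / 2 := by
  simp only [cost, facLoc, min_lt_iff, if_true, Bool.not_false, Bool.false_eq_true, if_false] at hC
  rcases hC with hC | hC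
  · exact hC
  · have hε' : ε < 1 / 16 := by nlinarith
    nlinarith [le_abs_self (z - y.1)]

/-- With private preferences and `n = 4` agents, no strategyproof mechanism has an
approximation ratio less than `max {1, α/4}` under the total cost objective. -/
theorem stmt_5 (α : ℝ) (hα : 1 ≤ α) (f : Loc 4 → Pref 4 → ℝ × ℝ)
    (hbox : ∀ x σ, inBox (f x σ)) (hSP : SPprefCost α f) (r : ℝ)
    (happrox : ∀ x : Loc 4, validLoc x → ∀ σ : Pref 4,
      SC α x σ (f x σ) ≤ r * optSC α x σ) :
    max 1 (α / 4) ≤ r := by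
  have hr1 := one_le_ratio hα f hbox r happrox
  refine max_le hr1 ?_
  by_contra! hr
  have hα4 : 4 < α := by linarith
  have hα0 : 0 ≤ α := by linarith
  obtain ⟨ε, hε⟩ : ∃ ε : ℝ, α * ε = 1 / 4 := ⟨1 / (4 * α), by field_simp⟩
  have hε0 : 0 < ε := by nlinarith
  have hε1 : ε < 1 / 16 := by nlinarith
  let x : Loc 4 := ![0, ε, 1 - ε, 1]
  have hx : validLoc x := by
    intro i
    fin_cases i <;> simp [x] <;> constructor <;> linarith
  have small : ∀ σ : Pref 4, ∀ y, inBox y → SC α x σ y ≤ 2 * ε →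
      ∀ i, cost α (x i) (σ i) (f x σ) < 1 / 8 := by
    intro σ y hy hσ i
    have h1 := cost_le_SC hα0 x σ (f x σ) i
    have h2 := happrox x hx σ
    have h3 := optSC_le hα0 x σ hy
    nlinarith
  let σ : Pref 4 := ![true, true, false, false]
  let σC : Pref 4 := ![true, true, true, false]
  let σD : Pref 4 := ![true, true, false, true]
  have hbox1 : inBox (0, 1) := by simp [inBox]
  have hbox2 : inBox (0, 1 - ε) := by
    refine ⟨by simp, ?_, ?_⟩ <;> dsimp only <;> linarith
  have cA : ∀ w, cost α 0 true (0, w) ≤ 0 := fun w =>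
    (cost_true_le _ _ _).trans (by simp)
  have cB : ∀ w, cost α ε true (0, w) ≤ ε := fun w =>
    (cost_true_le _ _ _).trans (by simp [abs_of_pos hε0])
  have cC : cost α (1 - ε) false (0, 1) ≤ ε :=
    (cost_false_le _ _ _).trans (by simp [abs_of_pos hε0])
  have cD : cost α 1 false (0, 1 - ε) ≤ ε :=
    (cost_false_le _ _ _).trans (by simp [abs_of_pos hε0])
  have s := small σ (0, 1) hbox1 (by
    simp only [SC, Fin.sum_univ_four]
    change cost α 0 true _ + cost α ε true _ + cost α (1 - ε) false _ + cost α 1 false _ ≤ _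
    linarith [cA 1, cB 1, cost_self_nonpos α 1 0 false])
  have sC := small σC (0, 1 - ε) hbox2 (by
    simp only [SC, Fin.sum_univ_four]
    change cost α 0 true _ + cost α ε true _ + cost α (1 - ε) true _ + cost α 1 false _ ≤ _
    linarith [cA (1 - ε), cB (1 - ε), cost_self_nonpos α (1 - ε) 0 true])
  have sD := small σD (0, 1) hbox1 (by
    simp only [SC, Fin.sum_univ_four]
    change cost α 0 true _ + cost α ε true _ + cost α (1 - ε) false _ + cost α 1 true _ ≤ _
    linarith [cA 1, cB 1, cost_self_nonpos α 1 0 true])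
  have left := fst_lt_of_cost_lt hα4 hε (s 0) (s 1)
  have nearC : |1 - ε - (f x σC).2| < ε / 2 := dist_snd_lt_of_cost_lt hα4 hε (by linarith)
    (fst_lt_of_cost_lt hα4 hε (sC 0) (sC 1)) (sC 2)
  have nearD : |1 - (f x σD).2| < ε / 2 := dist_snd_lt_of_cost_lt hα4 hε (by norm_num)
    (fst_lt_of_cost_lt hα4 hε (sD 0) (sD 1)) (sD 3)
  have upC : Function.update σ 2 true = σC := by
    funext i
    fin_cases i <;> rfl
  have upD : Function.update σ 3 true = σD := by
    funext i
    fin_cases i <;> rfl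
  have spC : cost α (1 - ε) false (f x σ) ≤ cost α (1 - ε) false (f x σC) :=
    upC ▸ hSP x hx σ 2 true
  have spD : cost α 1 false (f x σ) ≤ cost α 1 false (f x σD) :=
    upD ▸ hSP x hx σ 3 true
  have hC := dist_snd_lt_of_cost_false_lt hα4 hε (by linarith) left
    ((spC.trans (cost_false_le _ _ _)).trans_lt nearC)
  have hD := dist_snd_lt_of_cost_false_lt hα4 hε (by norm_num) left
    ((spD.trans (cost_false_le _ _ _)).trans_lt nearD)
  linarith [neg_abs_le (1 - ε - (f x σ).2), le_abs_self (1 - (f x σ).2)]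
end

section
/- For every coefficient α ≥ 1 and every number of agents n, Mechanism 1 is group strategyproof in the private-preferences setting and α-approximate under the minimum utility objective. -/
open scoped BigOperators

/-- Among three points with consecutive gaps at least `δ`, one is at distance at least `δ / 2`
from both of two given points. -/
theorem exists_far_of_gaps {a b c δ : ℝ} (hab : δ ≤ b - a) (hbc : δ ≤ c - b) (hδ : 0 ≤ δ)
    (u v : ℝ) :
    ∃ p, (p = a ∨ p = b ∨ p = c) ∧ δ / 2 ≤ |p - u| ∧ δ / 2 ≤ |p - v| := by
  by_contra! h
  have ha := h a (by simp)
  have hb := h b (by simp)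
  have hc := h c (by simp)
  have key : ∀ p q w : ℝ, δ ≤ q - p → δ / 2 ≤ |p - w| ∨ δ / 2 ≤ |q - w| := by
    intro p q w hpq
    by_contra! hlt
    linarith [neg_abs_le (p - w), le_abs_self (q - w)]
  rcases key a b u hab with h1 | h1 <;> rcases key a b v hab with h2 | h2 <;>
    rcases key b c u hbc with h3 | h3 <;> rcases key b c v hbc with h4 | h4 <;>
    rcases key a c u (by linarith) with h5 | h5 <;>
    rcases key a c v (by linarith) with h6 | h6 <;>
    first
    | linarith [ha ‹_›]
    | linarith [hb ‹_›]
    | linarith [hc ‹_›]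

/-- An agent at distance at least `d ≤ 1` from both facilities has utility at most `1 - d`. -/
theorem util_le_of_far {α z d : ℝ} (hα : 1 ≤ α) (hd : d ≤ 1) (s : Bool) {y : ℝ × ℝ}
    (h1 : d ≤ |z - y.1|) (h2 : d ≤ |z - y.2|) : util α z s y ≤ 1 - d := by
  have hfac : ∀ b, d ≤ |z - facLoc y b| := by
    intro b
    cases b <;> simpa [facLoc]
  refine max_le (by linarith [hfac s]) ?_
  rw [div_le_iff₀ (by linarith)]
  nlinarith [hfac (!s)]

/-- An agent within distance `d ≤ 1` of some facility has utility at least `(1 - d) / α`. -/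
theorem le_util_of_near {α z d : ℝ} (hα : 1 ≤ α) (hd : d ≤ 1) (s b : Bool) {y : ℝ × ℝ}
    (h : |z - facLoc y b| ≤ d) : (1 - d) / α ≤ util α z s y := by
  have hα0 : 0 < α := by linarith
  by_cases hb : b = s
  · subst hb
    refine le_max_of_le_left ?_
    rw [div_le_iff₀ hα0]
    nlinarith
  · have hb' : b = !s := by cases b <;> cases s <;> simp_all
    subst hb'
    refine le_max_of_le_right ?_
    gcongr

/-- Three agents with consecutive gaps at least `δ` force the minimum utility to be at most
`1 - δ / 2`. -/
theorem BU_le_of_gaps {n : ℕ} {α δ : ℝ} (hα : 1 ≤ α) {x : Loc n} (σ : Pref n) {a b c : Fin n}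
    (hab : δ ≤ x b - x a) (hbc : δ ≤ x c - x b) (hδ : 0 ≤ δ) (hδ1 : δ ≤ 1) (y : ℝ × ℝ) :
    BU α x σ y ≤ 1 - δ / 2 := by
  obtain ⟨p, hp, h1, h2⟩ := exists_far_of_gaps hab hbc hδ y.1 y.2
  obtain ⟨i, rfl⟩ : ∃ i, x i = p := by
    rcases hp with rfl | rfl | rfl <;> exact ⟨_, rfl⟩
  exact (ciInf_le (Set.finite_range _).bddBelow i).trans
    (util_le_of_far hα (by linarith) (σ i) h1 h2)

theorem BU_div_le_util_mech1 {n : ℕ} {α : ℝ} (hα : 1 ≤ α) {x : Loc n} (hx : validLoc x)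
    (σ : Pref n) (k : Fin n) (y : ℝ × ℝ) :
    BU α x σ y / α ≤ util α (x k) (σ k) (mech1 x) := by
  have : Nonempty (Fin n) := ⟨k⟩
  have hα0 : 0 < α := by linarith
  obtain ⟨l, hl⟩ := exists_eq_ciInf_of_finite (f := x)
  obtain ⟨r, hr⟩ := exists_eq_ciSup_of_finite (f := x)
  have hmin : ∀ i, x l ≤ x i := fun i => hl ▸ ciInf_le (Set.finite_range x).bddBelow i
  have hmax : ∀ i, x i ≤ x r := fun i => hr ▸ le_ciSup (Set.finite_range x).bddAbove i
  have hl0 := (hx l).1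
  have hr1 := (hx r).2
  rcases le_total (x k) ((x l + x r) / 2) with hk | hk
  · set S := {z | (∃ i, x i = z) ∧ z ≤ (x l + x r) / 2} with hS
    have hfin : S.Finite := (Set.finite_range x).subset fun z hz => hz.1
    have hkS : x k ∈ S := ⟨⟨k, rfl⟩, hk⟩
    obtain ⟨⟨b, hb⟩, hbc⟩ := Set.Nonempty.csSup_mem ⟨_, hkS⟩ hfin
    have hkb : x k ≤ x b := hb ▸ le_csSup hfin.bddAbove hkS
    rw [← hb] at hbc
    have hy : facLoc (mech1 x) true = x l / 2 + x b / 2 := by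
      simp [facLoc, mech1, ← hl, ← hr, hb, hS]
    have hlk := hmin k
    refine le_trans ?_ (le_util_of_near (d := (x b - x l) / 2) hα (by linarith) (σ k) true ?_)
    · gcongr
      exact BU_le_of_gaps hα σ (a := l) (b := b) (c := r) le_rfl (by linarith) (by linarith)
        (by linarith) y
    · rw [hy, abs_le]
      constructor <;> linarith
  · set S := {z | (∃ i, x i = z) ∧ (x l + x r) / 2 ≤ z} with hS
    have hfin : S.Finite := (Set.finite_range x).subset fun z hz => hz.1
    have hkS : x k ∈ S := ⟨⟨k, rfl⟩, hk⟩
    obtain ⟨⟨b, hb⟩, hbc⟩ := Set.Nonempty.csInf_mem ⟨_, hkS⟩ hfin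
    have hkb : x b ≤ x k := hb ▸ csInf_le hfin.bddBelow hkS
    rw [← hb] at hbc
    have hy : facLoc (mech1 x) false = x r / 2 + x b / 2 := by
      simp [facLoc, mech1, ← hl, ← hr, hb, hS]
    have hkr := hmax k
    refine le_trans ?_ (le_util_of_near (d := (x r - x b) / 2) hα (by linarith) (σ k) false ?_)
    · gcongr
      exact BU_le_of_gaps hα σ (a := l) (b := b) (c := r) (by linarith) le_rfl (by linarith)
        (by linarith) y
    · rw [hy, abs_le]
      constructor <;> linarith

/-- Mechanism 1 is group strategyproof with private preferences and `α`-approximate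
under the minimum utility objective. -/
theorem stmt_6 (α : ℝ) (hα : 1 ≤ α) (n : ℕ) :
    GSPprefUtil α (fun (x : Loc n) (_ : Pref n) => mech1 x) ∧
    ∀ x : Loc n, validLoc x → ∀ σ : Pref n,
      optBU α x σ / α ≤ BU α x σ (mech1 x) := by
  refine ⟨fun x _ σ σ' hne => ?_, fun x hx σ => ?_⟩
  · obtain ⟨i, hi⟩ := Function.ne_iff.mp hne
    exact ⟨i, hi, le_rfl⟩
  · have hα0 : 0 < α := by linarith
    rw [div_le_iff₀ hα0]
    refine csSup_le ⟨_, (0, 0), by simp [inBox], rfl⟩ ?_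
    rintro _ ⟨y, -, rfl⟩
    rw [← div_le_iff₀ hα0]
    rcases isEmpty_or_nonempty (Fin n) with h | h
    · simp [BU, Real.iInf_of_isEmpty]
    · exact le_ciInf fun k => BU_div_le_util_mech1 hα hx σ k y
end

section
/- For every coefficient α ≥ 1 and every number of agents n, there exists a group strategyproof mechanism in the private-preferences setting whose approximation ratio under the total utility objective is min{2, α}. -/
open scoped BigOperators

/-- The utility of an agent at `t` who likes both facilities equally. -/
noncomputable def indifferentUtil (t : ℝ) (y : ℝ × ℝ) : ℝ :=
  max (1 - |t - y.1|) (1 - |t - y.2|)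

theorem abs_sub_le_one {s t : ℝ} (hs : s ∈ Set.Icc (0 : ℝ) 1) (ht : t ∈ Set.Icc (0 : ℝ) 1) :
    |s - t| ≤ 1 :=
  abs_le.2 ⟨by linarith [hs.1, ht.2], by linarith [hs.2, ht.1]⟩

theorem util_le_indifferentUtil {α t : ℝ} (hα : 1 ≤ α) (ht : t ∈ Set.Icc (0 : ℝ) 1) (b : Bool)
    {y : ℝ × ℝ} (hy : inBox y) : util α t b y ≤ indifferentUtil t y := by
  have h1 := div_le_self (sub_nonneg.2 (abs_sub_le_one ht hy.1)) hα
  have h2 := div_le_self (sub_nonneg.2 (abs_sub_le_one ht hy.2)) hα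
  cases b <;> simp only [util, indifferentUtil, facLoc, Bool.not_true, Bool.not_false,
    if_true, Bool.false_eq_true, if_false]
  · exact max_le (le_max_right _ _) (h1.trans (le_max_left _ _))
  · exact max_le (le_max_left _ _) (h2.trans (le_max_right _ _))

theorem indifferentUtil_div_le_util {α t : ℝ} (hα : 1 ≤ α) (ht : t ∈ Set.Icc (0 : ℝ) 1) (b : Bool)
    {y : ℝ × ℝ} (hy : inBox y) : indifferentUtil t y / α ≤ util α t b y := by
  have h1 := div_le_self (sub_nonneg.2 (abs_sub_le_one ht hy.1)) hα
  have h2 := div_le_self (sub_nonneg.2 (abs_sub_le_one ht hy.2)) hα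
  rw [indifferentUtil, ← max_div_div_right (zero_le_one.trans hα)]
  cases b <;> simp only [util, facLoc, Bool.not_true, Bool.not_false,
    if_true, Bool.false_eq_true, if_false]
  · exact max_le (le_max_right _ _) (h2.trans (le_max_left _ _))
  · exact max_le (h1.trans (le_max_left _ _)) (le_max_right _ _)

theorem indifferentUtil_le_one (t : ℝ) (y : ℝ × ℝ) : indifferentUtil t y ≤ 1 :=
  max_le (by linarith [abs_nonneg (t - y.1)]) (by linarith [abs_nonneg (t - y.2)])

theorem half_le_util_mech3 (α : ℝ) {t : ℝ} (ht : t ∈ Set.Icc (0 : ℝ) 1) (b : Bool) :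
    1 / 2 ≤ util α t b mech3 := by
  have h : |t - 1 / 2| ≤ 1 / 2 := abs_le.2 ⟨by linarith [ht.1], by linarith [ht.2]⟩
  refine le_trans ?_ (le_max_left _ _)
  cases b <;> simp only [facLoc, mech3, ite_self] <;> linarith

theorem optSU_le {n : ℕ} {α c : ℝ} {x : Loc n} {σ : Pref n}
    (h : ∀ y, inBox y → SU α x σ y ≤ c) : optSU α x σ ≤ c := by
  refine csSup_le ⟨_, (0, 0), by simp [inBox], rfl⟩ ?_
  rintro _ ⟨y, hy, rfl⟩
  exact h y hy

theorem exists_maximizer_sum_indifferentUtil {n : ℕ} (x : Loc n) :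
    ∃ y, inBox y ∧ ∀ z, inBox z →
      ∑ i, indifferentUtil (x i) z ≤ ∑ i, indifferentUtil (x i) y := by
  have hc : Continuous fun y : ℝ × ℝ => ∑ i, indifferentUtil (x i) y := by
    unfold indifferentUtil
    fun_prop
  obtain ⟨y, hy, hmax⟩ := (isCompact_Icc.prod isCompact_Icc).exists_isMaxOn
    (s := Set.Icc (0 : ℝ) 1 ×ˢ Set.Icc (0 : ℝ) 1) ⟨(0, 0), by simp⟩ hc.continuousOn
  exact ⟨y, hy, fun z hz => hmax hz⟩

theorem gspPrefUtil_of_loc {n : ℕ} (α : ℝ) (g : Loc n → ℝ × ℝ) :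
    GSPprefUtil α fun x _ => g x := by
  intro x _ σ σ' h
  obtain ⟨i, hi⟩ := Function.ne_iff.1 h
  exact ⟨i, hi, le_rfl⟩

/-- With private preferences, there exists a group strategyproof mechanism that is
`min {2, α}`-approximate under the total utility objective. -/
theorem stmt_10 (α : ℝ) (hα : 1 ≤ α) (n : ℕ) :
    ∃ f : Loc n → Pref n → ℝ × ℝ,
      (∀ x σ, inBox (f x σ)) ∧ GSPprefUtil α f ∧
      ∀ x : Loc n, validLoc x → ∀ σ : Pref n,
        optSU α x σ / min 2 α ≤ SU α x σ (f x σ) := by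
  rcases le_total 2 α with h | h
  · refine ⟨fun _ _ => mech3, fun _ _ => by norm_num [inBox, mech3],
      gspPrefUtil_of_loc α _, fun x hx σ => ?_⟩
    rw [min_eq_left h, div_le_iff₀ two_pos]
    refine optSU_le fun y hy => ?_
    rw [SU, SU, Finset.sum_mul]
    refine Finset.sum_le_sum fun i _ => ?_
    linarith [util_le_indifferentUtil hα (hx i) (σ i) hy, indifferentUtil_le_one (x i) y,
      half_le_util_mech3 α (hx i) (σ i)]
  · choose g hg hmax using exists_maximizer_sum_indifferentUtil (n := n)
    refine ⟨fun x _ => g x, fun x _ => hg x, gspPrefUtil_of_loc α g, fun x hx σ => ?_⟩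
    rw [min_eq_right h]
    have hpos : 0 < α := zero_lt_one.trans_le hα
    calc optSU α x σ / α ≤ (∑ i, indifferentUtil (x i) (g x)) / α := by
          gcongr
          exact optSU_le fun y hy => (Finset.sum_le_sum fun i _ =>
            util_le_indifferentUtil hα (hx i) (σ i) hy).trans (hmax x y hy)
      _ ≤ SU α x σ (g x) := by
          rw [Finset.sum_div]
          exact Finset.sum_le_sum fun i _ =>
            indifferentUtil_div_le_util hα (hx i) (σ i) (hg x)
end
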